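/- arXiv:1612.00313 — 5 statements merged into one kernel-verified Lean document; each statement's English description precedes it below -/
import Mathlib

section
/- Let Q be a finite set and let E = Q^n be equipped with the Hamming distance d. For any x, y ∈ E, the metric segment [x,y] equals the set of all z ∈ E such that for every coordinate i (1 ≤ i ≤ n), the i-th coordinate π_i(z) of z belongs to {π_i(x), π_i(y)}. -/
variable {Q : Type*} [Fintype Q] [DecidableEq Q] {n : ℕ}

/-- The metric segment `[x,y]` in the Hamming space `Q^n`: the set of `z` with
`d(x,y) = d(x,z) + d(z,y)` for the Hamming distance `d`. -/
def hammingSeg (x y : Fin n → Q) : Set (Fin n → Q) :=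
  {z | hammingDist x y = hammingDist x z + hammingDist z y}

/-- For any `x, y ∈ Q^n`, the Hamming metric segment `[x,y]` equals the set of `z`
all of whose coordinates agree with the corresponding coordinate of `x` or of `y`. -/
theorem hammingSeg_eq (x y : Fin n → Q) :
    hammingSeg x y = {z : Fin n → Q | ∀ i : Fin n, z i = x i ∨ z i = y i} := by
  ext z
  simp only [hammingSeg, Set.mem_ofPred_eq, hammingDist, Finset.card_filter,
    ← Finset.sum_add_distrib]
  rw [Finset.sum_eq_sum_iff_of_le fun i _ => by grind]
  simp only [Finset.mem_univ, forall_const]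
  exact forall_congr' fun i => by grind
end

section
/- Let Q be a finite set and let E = Q^n be equipped with the Hamming distance. In this metric space, segments are convex: for any x, y ∈ E and any z, w ∈ [x,y], one has [z,w] ⊆ [x,y]. -/
variable {Q : Type*} [Fintype Q] [DecidableEq Q] {n : ℕ}

/-- A point lies in the Hamming segment `[x,y]` iff each of its coordinates agrees with that of
`x` or that of `y`. -/
theorem mem_hammingSeg_iff {α : Type*} [DecidableEq α] {m : ℕ} {x y z : Fin m → α} :
    z ∈ hammingSeg x y ↔ ∀ i, z i = x i ∨ z i = y i := by
  simp only [hammingSeg, Set.mem_ofPred_eq, hammingDist, Finset.card_filter,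
    ← Finset.sum_add_distrib]
  rw [Finset.sum_eq_sum_iff_of_le fun i _ => by grind]
  simp only [Finset.mem_univ, true_imp_iff]
  exact forall_congr' fun i => by grind

/-- In the Hamming space `Q^n`, segments are convex: if `z, w ∈ [x,y]` then `[z,w] ⊆ [x,y]`. -/
theorem hammingSeg_convex (x y z w : Fin n → Q)
    (hz : z ∈ hammingSeg x y) (hw : w ∈ hammingSeg x y) :
    hammingSeg z w ⊆ hammingSeg x y := by
  intro u hu
  rw [mem_hammingSeg_iff] at hz hw hu ⊢
  intro i
  rcases hu i with h | h
  · exact h ▸ hz i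
  · exact h ▸ hw i
end

section
/- Discrete Hahn-Banach theorem: let Q be a finite set and let E = Q^n be equipped with the Hamming distance. For any convex set K ⊆ E (with respect to Hamming metric convexity) and any x ∉ K, with K nonempty, there exists a coordinate i (1 ≤ i ≤ n) that separates x from K, in the sense that π_i(x) ∉ π_i(K). -/
variable {Q : Type*} [Fintype Q] [DecidableEq Q] {n : ℕ}

/-- A subset `K ⊆ Q^n` is convex (for the Hamming metric) if it contains the segment
between any two of its points. -/
def HammingConvex (K : Set (Fin n → Q)) : Prop :=
  ∀ x ∈ K, ∀ y ∈ K, hammingSeg x y ⊆ K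

/-- A point each of whose coordinates is taken from `y` or `z` lies in the segment `[y,z]`. -/
theorem mem_hammingSeg_of_forall_eq_or_eq {y z w : Fin n → Q}
    (h : ∀ i, w i = y i ∨ w i = z i) : w ∈ hammingSeg y z := by
  simp only [hammingSeg, Set.mem_ofPred_eq, hammingDist, Finset.card_filter]
  rw [← Finset.sum_add_distrib]
  refine Finset.sum_congr rfl fun i _ => ?_
  rcases h i with h | h <;> simp [h]

/-- If every coordinate of `x` is attained on a nonempty convex set `K`, then any finite set of
coordinates of `x` is attained simultaneously by a point of `K`. -/
theorem HammingConvex.exists_mem_forall_eq {K : Set (Fin n → Q)} (hK : HammingConvex K)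
    (hne : K.Nonempty) {x : Fin n → Q} (hx : ∀ i, ∃ z ∈ K, z i = x i) (s : Finset (Fin n)) :
    ∃ y ∈ K, ∀ i ∈ s, y i = x i := by
  induction s using Finset.induction_on with
  | empty => simpa [Set.Nonempty] using hne
  | insert i s _ ih =>
    obtain ⟨y, hy, hys⟩ := ih
    obtain ⟨z, hz, hzi⟩ := hx i
    refine ⟨Function.update y i (x i),
      hK y hy z hz (mem_hammingSeg_of_forall_eq_or_eq fun j => ?_), fun j hj => ?_⟩
    · rcases eq_or_ne j i with rfl | hji
      · simp [hzi]
      · simp [hji]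
    · rcases eq_or_ne j i with rfl | hji
      · simp
      · simpa [hji] using hys j (Finset.mem_of_mem_insert_of_ne hj hji)

/-- Discrete Hahn–Banach theorem: given a nonempty Hamming-convex set `K ⊆ Q^n`
and `x ∉ K`, there is a coordinate `i` separating `x` from `K`,
i.e. `π_i(x) ∉ π_i(K)`. -/
theorem discrete_hahn_banach (K : Set (Fin n → Q)) (hK : HammingConvex K)
    (hne : K.Nonempty) (x : Fin n → Q) (hx : x ∉ K) :
    ∃ i : Fin n, x i ∉ (fun z : Fin n → Q => z i) '' K := by
  by_contra! h
  obtain ⟨y, hy, hyx⟩ := hK.exists_mem_forall_eq hne h Finset.univ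
  exact hx (funext (fun i => hyx i (Finset.mem_univ i)) ▸ hy)
end

section
/- In real L¹ space, i.e., ℝ^n equipped with the norm ‖x‖_{L¹} = |π_1(x)| + ⋯ + |π_n(x)|, metric segments are convex: for any x, y ∈ ℝ^n and any z, w ∈ [x,y], one has [z,w] ⊆ [x,y]. -/
variable {n : ℕ}

/-- The L¹ distance on `ℝⁿ`, induced by the norm `‖x‖_{L¹} = |x 1| + ⋯ + |x n|`. -/
def l1Dist (x y : Fin n → ℝ) : ℝ := ∑ i, |x i - y i|

/-- The metric segment `[x,y]` in real L¹ space. -/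
def l1Seg (x y : Fin n → ℝ) : Set (Fin n → ℝ) :=
  {z | l1Dist x y = l1Dist x z + l1Dist z y}

/-- Membership in a metric segment of real L¹ space is a coordinatewise condition. -/
theorem mem_l1Seg_iff (x y z : Fin n → ℝ) :
    z ∈ l1Seg x y ↔ ∀ i, z i ∈ Set.uIcc (x i) (y i) := by
  have hcoord (a b c : ℝ) : |a - b| = |a - c| + |c - b| ↔ c ∈ Set.uIcc a b := by
    rw [Set.mem_uIcc]
    grind
  simp only [l1Seg, l1Dist, Set.mem_ofPred_eq, ← Finset.sum_add_distrib]
  rw [Finset.sum_eq_sum_iff_of_le fun i _ => abs_sub_le (x i) (z i) (y i)]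
  simp [hcoord]

/-- In real L¹ space, metric segments are convex: if `z, w ∈ [x,y]` then `[z,w] ⊆ [x,y]`. -/
theorem l1Seg_convex (x y z w : Fin n → ℝ)
    (hz : z ∈ l1Seg x y) (hw : w ∈ l1Seg x y) :
    l1Seg z w ⊆ l1Seg x y := by
  intro v hv
  rw [mem_l1Seg_iff] at hz hw hv ⊢
  exact fun i => Set.uIcc_subset_uIcc (hz i) (hw i) (hv i)
end

section
/- In real L¹ space, i.e., ℝ^n equipped with the norm ‖x‖_{L¹} = |π_1(x)| + ⋯ + |π_n(x)|, the metric convex hull of a finite nonempty set S ⊆ ℝ^n equals the smallest enclosing box: hull(S) = {z ∈ ℝ^n | for all i, min_{s∈S} π_i(s) ≤ π_i(z) ≤ max_{s∈S} π_i(s)}. -/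
variable {n : ℕ}

/-- A subset `K ⊆ ℝⁿ` is convex for the L¹ metric if it contains the L¹ metric segment
between any two of its points. -/
def L1Convex (K : Set (Fin n → ℝ)) : Prop :=
  ∀ x ∈ K, ∀ y ∈ K, l1Seg x y ⊆ K

/-- The L¹ metric convex hull: the smallest L¹-convex set containing `S`. -/
def l1Hull (S : Set (Fin n → ℝ)) : Set (Fin n → ℝ) :=
  ⋂₀ {K : Set (Fin n → ℝ) | L1Convex K ∧ S ⊆ K}

theorem abs_sub_eq_add_iff_mem_uIcc {a b c : ℝ} :
    |a - b| = |a - c| + |c - b| ↔ c ∈ Set.uIcc a b := by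
  rw [Set.mem_uIcc]
  grind

/-- The L¹ metric segment between two points is the box they span. -/
theorem l1Seg_eq_uIcc (x y : Fin n → ℝ) : l1Seg x y = Set.uIcc x y := by
  ext z
  have mem_uIcc_iff : z ∈ Set.uIcc x y ↔ ∀ i, z i ∈ Set.uIcc (x i) (y i) := by
    simp only [Set.uIcc, Set.mem_Icc, Pi.le_def, Pi.inf_apply, Pi.sup_apply, forall_and]
  simp only [l1Seg, l1Dist, Set.mem_ofPred_eq, mem_uIcc_iff, ← Finset.sum_add_distrib,
    ← abs_sub_eq_add_iff_mem_uIcc]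
  rw [Finset.sum_eq_sum_iff_of_le fun i _ => abs_sub_le (x i) (z i) (y i)]
  simp

theorem l1Convex_Icc (a b : Fin n → ℝ) : L1Convex (Set.Icc a b) := by
  intro x hx y hy
  rw [l1Seg_eq_uIcc]
  exact Set.uIcc_subset_Icc hx hy

theorem L1Convex.uIcc_subset {K : Set (Fin n → ℝ)} (hK : L1Convex K) {x y : Fin n → ℝ}
    (hx : x ∈ K) (hy : y ∈ K) : Set.uIcc x y ⊆ K :=
  l1Seg_eq_uIcc x y ▸ hK x hx y hy

theorem L1Convex.inf_mem {K : Set (Fin n → ℝ)} (hK : L1Convex K) :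
    ∀ x ∈ K, ∀ y ∈ K, x ⊓ y ∈ K :=
  fun _ hx _ hy => hK.uIcc_subset hx hy ⟨le_rfl, inf_le_sup⟩

theorem L1Convex.sup_mem {K : Set (Fin n → ℝ)} (hK : L1Convex K) :
    ∀ x ∈ K, ∀ y ∈ K, x ⊔ y ∈ K :=
  fun _ hx _ hy => hK.uIcc_subset hx hy ⟨inf_le_sup, le_rfl⟩

theorem l1Hull_eq_Icc (S : Finset (Fin n → ℝ)) (hS : S.Nonempty) :
    l1Hull (↑S : Set (Fin n → ℝ)) = Set.Icc (S.inf' hS id) (S.sup' hS id) := by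
  apply Set.Subset.antisymm
  · exact Set.sInter_subset_of_mem
      ⟨l1Convex_Icc _ _, fun s hs => ⟨Finset.inf'_le id hs, Finset.le_sup' id hs⟩⟩
  · rintro z hz K ⟨hK, hSK⟩
    exact hK.uIcc_subset (Finset.inf'_mem K hK.inf_mem S hS id fun _ hs => hSK hs)
      (Finset.sup'_mem K hK.sup_mem S hS id fun _ hs => hSK hs) (Set.Icc_subset_uIcc hz)

/-- In real L¹ space, the metric convex hull of a finite nonempty set is its smallest
enclosing box. -/
theorem l1Hull_eq_box (S : Finset (Fin n → ℝ)) (hS : S.Nonempty) :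
    l1Hull (↑S : Set (Fin n → ℝ)) =
      {z : Fin n → ℝ | ∀ i : Fin n,
        S.inf' hS (fun s => s i) ≤ z i ∧ z i ≤ S.sup' hS (fun s => s i)} := by
  ext z
  simp only [l1Hull_eq_Icc S hS, Set.mem_Icc, Set.mem_ofPred_eq, Pi.le_def, Finset.inf'_apply,
    Finset.sup'_apply, id_eq, forall_and]
end
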